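/- Let R be a commutative noetherian local ring, let M be a totally reflexive R-module and let Q be a finitely generated R-module of finite injective dimension. Then Tor_i^R(M,Q) = 0 for all i > 0, and depth_R(M ⊗_R Q) + depth R = depth_R(M) + depth_R(Q) (so, since depth_R(M) = depth R when M ≠ 0, depth_R(M ⊗_R Q) = depth_R(Q)). -/

import Mathlib

open CategoryTheory

universe u

/-- The `i`-th Ext module `Ext_R^i(M, N)` of `R`-modules `M` and `N`. -/
noncomputable def extModule (R : Type u) [CommRing R] (M N : Type u)
    [AddCommGroup M] [Module R M] [AddCommGroup N] [Module R N] (i : ℕ) : ModuleCat.{u} R :=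
  ((Ext R (ModuleCat.{u} R) i).obj (Opposite.op (ModuleCat.of R M))).obj (ModuleCat.of R N)

/-- The `i`-th Tor module `Tor^R_i(M, N)` of `R`-modules `M` and `N`. -/
noncomputable def torModule (R : Type u) [CommRing R] (M N : Type u)
    [AddCommGroup M] [Module R M] [AddCommGroup N] [Module R N] (i : ℕ) : ModuleCat.{u} R :=
  ((Tor (ModuleCat.{u} R) i).obj (ModuleCat.of R M)).obj (ModuleCat.of R N)

/-- The depth of a module `M` over a local ring `R`:
`inf { i | Ext^i_R(k, M) ≠ 0 }` where `k` is the residue field, an element of `ℕ∞`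
(the zero module has depth `⊤`, since the infimum of the empty set in `ℕ∞` is `⊤`). -/
noncomputable def moduleDepth (R : Type u) [CommRing R] [IsLocalRing R] (M : Type u)
    [AddCommGroup M] [Module R M] : ℕ∞ :=
  sInf {i : ℕ∞ | ∃ n : ℕ, i = (n : ℕ∞) ∧
    Nontrivial (extModule R (IsLocalRing.ResidueField R) M n)}

/-- A module `M` is totally reflexive if the canonical evaluation map `M → M**` is bijective
and `Ext^i_R(M, R) = 0 = Ext^i_R(M*, R)` for all `i > 0`. -/
def IsTotallyReflexive (R : Type u) [CommRing R] (M : Type u)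
    [AddCommGroup M] [Module R M] : Prop :=
  Function.Bijective (Module.Dual.eval R M) ∧
    (∀ i : ℕ, 0 < i → Subsingleton (extModule R M R i)) ∧
    (∀ i : ℕ, 0 < i → Subsingleton (extModule R (Module.Dual R M) R i))

/-- A module `P` has finite projective dimension iff for some `n`, `Ext^i_R(P, -)` vanishes
for all `i > n`. -/
def HasFiniteProjectiveDimension (R : Type u) [CommRing R] (P : Type u)
    [AddCommGroup P] [Module R P] : Prop :=
  ∃ n : ℕ, ∀ (N : Type u) [AddCommGroup N] [Module R N] (i : ℕ), n < i →
    Subsingleton (extModule R P N i)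

/-- A module `Q` has finite injective dimension iff for some `n`, `Ext^i_R(-, Q)` vanishes
for all `i > n`. -/
def HasFiniteInjectiveDimension (R : Type u) [CommRing R] (Q : Type u)
    [AddCommGroup Q] [Module R Q] : Prop :=
  ∃ n : ℕ, ∀ (N : Type u) [AddCommGroup N] [Module R N] (i : ℕ), n < i →
    Subsingleton (extModule R N Q i)

section ExtVanishing

variable {R : Type u} [CommRing R]

/-- Vanishing of `Ext^n_R(M, N)`, phrased with the derived-category `Ext`. -/
def ExtVanishes (R : Type u) [CommRing R] (M N : Type u)
    [AddCommGroup M] [Module R M] [AddCommGroup N] [Module R N] (n : ℕ) : Prop :=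
  Subsingleton (Abelian.Ext (ModuleCat.of R M) (ModuleCat.of R N) n)

lemma subsingleton_ext_iff_of_projectiveResolution {M : ModuleCat.{u} R}
    (P : ProjectiveResolution M) (N : ModuleCat.{u} R) (n : ℕ) :
    Subsingleton (((Ext R (ModuleCat.{u} R) n).obj (Opposite.op M)).obj N) ↔
      Subsingleton (Abelian.Ext M N n) := by
  rw [(P.isoExt n N).toLinearEquiv.toEquiv.subsingleton_congr,
    ← ModuleCat.isZero_iff_subsingleton,
    ← HomologicalComplex.exactAt_iff_isZero_homology]
  rw [subsingleton_iff_forall_eq (0 : Abelian.Ext M N n)]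
  rcases n with _ | n
  · rw [HomologicalComplex.exactAt_iff' _ 0 0 1 (by simp) (by simp),
      ShortComplex.moduleCat_exact_iff]
    constructor
    · intro h α
      obtain ⟨f, hf, rfl⟩ := P.extMk_surjective α 1 rfl
      obtain ⟨x, hx⟩ := h f hf
      obtain rfl : f = 0 := by
        rw [← hx]
        change P.complex.d 0 0 ≫ (show P.complex.X 0 ⟶ N from x) = 0
        rw [P.complex.shape _ _ (by simp), Limits.zero_comp]
      exact P.extMk_zero _ _
    · intro h f hf
      refine ⟨0, (map_zero _).trans (Eq.symm ?_)⟩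
      have hd : P.complex.d 1 0 ≫ (show P.complex.X 0 ⟶ N from f) = 0 := hf
      obtain ⟨l, hl⟩ := P.exact₀.desc' _ hd
      have hl₀ : (show M ⟶ N from l) = 0 := (Abelian.Ext.mk₀_eq_zero_iff _).1 (h _)
      exact hl.symm.trans ((congrArg (P.π.f 0 ≫ ·) hl₀).trans Limits.comp_zero)
  · rw [HomologicalComplex.exactAt_iff' _ n (n + 1) (n + 2) (by simp) (by simp),
      ShortComplex.moduleCat_exact_iff]
    constructor
    · intro h α
      obtain ⟨f, hf, rfl⟩ := P.extMk_surjective α (n + 2) rfl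
      rw [P.extMk_eq_zero_iff f _ rfl hf n rfl]
      exact h f hf
    · intro h f hf
      exact (P.extMk_eq_zero_iff f _ rfl hf n rfl).1 (h _)

lemma subsingleton_extModule_iff (M N : Type u)
    [AddCommGroup M] [Module R M] [AddCommGroup N] [Module R N] (n : ℕ) :
    Subsingleton (extModule R M N n) ↔ ExtVanishes R M N n :=
  subsingleton_ext_iff_of_projectiveResolution (ProjectiveResolution.of (ModuleCat.of R M)) _ n

variable {A B C X Y : Type u} [AddCommGroup A] [Module R A] [AddCommGroup B] [Module R B]
  [AddCommGroup C] [Module R C] [AddCommGroup X] [Module R X] [AddCommGroup Y] [Module R Y]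
  {f : A →ₗ[R] B} {g : B →ₗ[R] C}

lemma extVanishes_of_projective [Module.Projective R X] (Y : Type u) [AddCommGroup Y] [Module R Y]
    (n : ℕ) : ExtVanishes R X Y (n + 1) :=
  Abelian.Ext.subsingleton_of_projective _ _ _

lemma ExtVanishes.congr_left {n : ℕ} (e : A ≃ₗ[R] B) (h : ExtVanishes R A Y n) :
    ExtVanishes R B Y n := by
  refine ⟨fun x y => ?_⟩
  have key (z : Abelian.Ext (ModuleCat.of R B) (ModuleCat.of R Y) n) :
      z = (Abelian.Ext.mk₀ e.toModuleIso.inv).comp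
        ((Abelian.Ext.mk₀ e.toModuleIso.hom).comp z (zero_add n)) (zero_add n) := by
    rw [Abelian.Ext.mk₀_comp_mk₀_assoc, Iso.inv_hom_id, Abelian.Ext.mk₀_id_comp]
  rw [key x, key y]
  congr 1
  exact h.elim _ _

lemma ExtVanishes.congr_right {n : ℕ} (e : A ≃ₗ[R] B) (h : ExtVanishes R X A n) :
    ExtVanishes R X B n := by
  refine ⟨fun x y => ?_⟩
  have key (z : Abelian.Ext (ModuleCat.of R X) (ModuleCat.of R B) n) :
      z = (z.comp (Abelian.Ext.mk₀ e.toModuleIso.inv) (add_zero n)).comp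
        (Abelian.Ext.mk₀ e.toModuleIso.hom) (add_zero n) := by
    rw [Abelian.Ext.comp_assoc_of_second_deg_zero, Abelian.Ext.mk₀_comp_mk₀, Iso.inv_hom_id,
      Abelian.Ext.comp_mk₀_id]
  rw [key x, key y]
  congr 1
  exact h.elim _ _

/-- The short complex in `ModuleCat R` attached to an exact pair of linear maps. -/
abbrev exactShortComplex (hfg : Function.Exact f g) : ShortComplex (ModuleCat.{u} R) :=
  ShortComplex.mk (ModuleCat.ofHom f) (ModuleCat.ofHom g) (by
    rw [← ModuleCat.ofHom_comp, hfg.linearMap_comp_eq_zero]; rfl)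

lemma shortExact_exactShortComplex (hf : Function.Injective f) (hfg : Function.Exact f g)
    (hg : Function.Surjective g) : (exactShortComplex hfg).ShortExact where
  exact := by
    rw [ShortComplex.ShortExact.moduleCat_exact_iff_function_exact]
    exact hfg
  mono_f := (ModuleCat.mono_iff_injective _).2 hf
  epi_g := (ModuleCat.epi_iff_surjective _).2 hg

lemma ExtVanishes.left_sub {n : ℕ} (hf : Function.Injective f) (hfg : Function.Exact f g)
    (hg : Function.Surjective g) (hB : ExtVanishes R B Y n) (hC : ExtVanishes R C Y (n + 1)) :
    ExtVanishes R A Y n := by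
  have hS := shortExact_exactShortComplex hf hfg hg
  refine subsingleton_of_forall_eq 0 fun x => ?_
  obtain ⟨y, rfl⟩ := Abelian.Ext.contravariant_sequence_exact₁ hS _ x (add_comm 1 n) (hC.elim _ _)
  rw [show y = 0 from hB.elim _ _, Abelian.Ext.comp_zero]

lemma ExtVanishes.left_quot {n : ℕ} (hf : Function.Injective f) (hfg : Function.Exact f g)
    (hg : Function.Surjective g) (hA : ExtVanishes R A Y n) (hB : ExtVanishes R B Y (n + 1)) :
    ExtVanishes R C Y (n + 1) := by
  have hS := shortExact_exactShortComplex hf hfg hg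
  refine subsingleton_of_forall_eq 0 fun x => ?_
  obtain ⟨y, rfl⟩ := Abelian.Ext.contravariant_sequence_exact₃ hS _ x (hB.elim _ _) (add_comm 1 n)
  rw [show y = 0 from hA.elim _ _, Abelian.Ext.comp_zero]

lemma ExtVanishes.left_quot_one (hf : Function.Injective f) (hfg : Function.Exact f g)
    (hg : Function.Surjective g) (hA : ∀ φ : A →ₗ[R] Y, ∃ ψ : B →ₗ[R] Y, ψ ∘ₗ f = φ)
    (hB : ExtVanishes R B Y 1) : ExtVanishes R C Y 1 := by
  have hS := shortExact_exactShortComplex hf hfg hg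
  refine subsingleton_of_forall_eq 0 fun x => ?_
  obtain ⟨y, rfl⟩ := Abelian.Ext.contravariant_sequence_exact₃ hS _ x (hB.elim _ _) (add_zero 1)
  obtain ⟨φ, rfl⟩ := Abelian.Ext.mk₀_bijective _ _ |>.surjective y
  obtain ⟨ψ, hψ⟩ := hA φ.hom
  have : φ = ModuleCat.ofHom f ≫ ModuleCat.ofHom ψ := by
    ext x
    exact (LinearMap.congr_fun hψ x).symm
  rw [this, ← Abelian.Ext.mk₀_comp_mk₀, ← Abelian.Ext.comp_assoc_of_second_deg_zero]
  rw [show hS.extClass.comp (Abelian.Ext.mk₀ (ModuleCat.ofHom f)) (add_zero 1) = 0 from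
    hS.extClass_comp, Abelian.Ext.zero_comp]

lemma ExtVanishes.exists_extension (hf : Function.Injective f) (hfg : Function.Exact f g)
    (hg : Function.Surjective g) (hC : ExtVanishes R C Y 1) (φ : A →ₗ[R] Y) :
    ∃ ψ : B →ₗ[R] Y, ψ ∘ₗ f = φ := by
  have hS := shortExact_exactShortComplex hf hfg hg
  obtain ⟨y, hy⟩ := Abelian.Ext.contravariant_sequence_exact₁ hS _
    (Abelian.Ext.mk₀ (ModuleCat.ofHom φ)) (add_zero 1) (hC.elim _ _)
  obtain ⟨ψ, rfl⟩ := Abelian.Ext.mk₀_bijective _ _ |>.surjective y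
  rw [Abelian.Ext.mk₀_comp_mk₀] at hy
  have := (Abelian.Ext.mk₀_bijective _ _).injective hy
  exact ⟨ψ.hom, congrArg ModuleCat.Hom.hom this⟩

lemma injective_ext_comp (hf : Function.Injective f) (hfg : Function.Exact f g)
    (hg : Function.Surjective g) {n : ℕ} (hC : ∀ i < n, ExtVanishes R X C i)
    (x : Abelian.Ext (ModuleCat.of R X) (ModuleCat.of R A) n)
    (hx : x.comp (Abelian.Ext.mk₀ (ModuleCat.ofHom f)) (add_zero n) = 0) : x = 0 := by
  have hS := shortExact_exactShortComplex hf hfg hg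
  rcases n with _ | n
  · have := hS.mono_f
    refine Abelian.Ext.postcomp_mk₀_injective_of_mono _ (exactShortComplex hfg).f ?_
    exact hx.trans (map_zero _).symm
  · obtain ⟨y, rfl⟩ := Abelian.Ext.covariant_sequence_exact₁ _ hS x hx rfl
    rw [show y = 0 from (hC n n.lt_succ_self).elim _ _, Abelian.Ext.zero_comp]

lemma ExtVanishes.right_sub (hf : Function.Injective f) (hfg : Function.Exact f g)
    (hg : Function.Surjective g) {n : ℕ} (hC : ∀ i < n, ExtVanishes R X C i)
    (hB : ExtVanishes R X B n) : ExtVanishes R X A n :=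
  subsingleton_of_forall_eq 0 fun x => injective_ext_comp hf hfg hg hC x (hB.elim _ _)

end ExtVanishing

section TotallyReflexive

variable {R : Type u} [CommRing R]

lemma isTotallyReflexive_iff (M : Type u) [AddCommGroup M] [Module R M] :
    IsTotallyReflexive R M ↔ Function.Bijective (Module.Dual.eval R M) ∧
      (∀ i : ℕ, ExtVanishes R M R (i + 1)) ∧
      ∀ i : ℕ, ExtVanishes R (Module.Dual R M) R (i + 1) := by
  simp only [IsTotallyReflexive, subsingleton_extModule_iff]
  refine and_congr_right' (and_congr ⟨fun h i => h _ i.succ_pos, fun h i hi => ?_⟩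
    ⟨fun h i => h _ i.succ_pos, fun h i hi => ?_⟩) <;>
  · obtain ⟨i, rfl⟩ := Nat.exists_eq_add_one.2 hi
    exact h i

variable {N F M Y : Type u} [AddCommGroup N] [Module R N] [AddCommGroup F] [Module R F]
  [AddCommGroup M] [Module R M] [AddCommGroup Y] [Module R Y]
  {f : N →ₗ[R] F} {g : F →ₗ[R] M}

lemma exact_lcomp (hfg : Function.Exact f g) (hg : Function.Surjective g) :
    Function.Exact (g.lcomp R Y) (f.lcomp R Y) := by
  intro φ
  constructor
  · intro h
    have hker : LinearMap.ker g ≤ LinearMap.ker φ := by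
      intro x hx
      obtain ⟨y, rfl⟩ := (hfg x).1 hx
      exact LinearMap.congr_fun h y
    refine ⟨(LinearMap.ker g).liftQ φ hker ∘ₗ (g.quotKerEquivOfSurjective hg).symm.toLinearMap, ?_⟩
    ext x
    have : (g.quotKerEquivOfSurjective hg).symm (g x) = Submodule.Quotient.mk x := by
      rw [LinearEquiv.symm_apply_eq]; rfl
    simp [this]
  · rintro ⟨ψ, rfl⟩
    ext x
    simp [hfg.apply_apply_eq_zero x]

lemma injective_lcomp (hg : Function.Surjective g) : Function.Injective (g.lcomp R Y) :=
  fun _ _ h => (LinearMap.cancel_right hg).1 h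

lemma surjective_lcomp (hf : Function.Injective f) (hfg : Function.Exact f g)
    (hg : Function.Surjective g) (hM : ExtVanishes R M Y 1) :
    Function.Surjective (f.lcomp R Y) :=
  fun φ => hM.exists_extension hf hfg hg φ

lemma IsTotallyReflexive.dual (hM : IsTotallyReflexive R M) :
    IsTotallyReflexive R (Module.Dual R M) := by
  rw [isTotallyReflexive_iff] at hM ⊢
  have : Module.IsReflexive R M := ⟨hM.1⟩
  exact ⟨Module.bijective_dual_eval R _, hM.2.2,
    fun i => (hM.2.1 i).congr_left (Module.evalEquiv R M)⟩

lemma IsTotallyReflexive.syzygy [Module.Finite R F] [Module.Projective R F]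
    (hM : IsTotallyReflexive R M) (hf : Function.Injective f) (hfg : Function.Exact f g)
    (hg : Function.Surjective g) : IsTotallyReflexive R N := by
  rw [isTotallyReflexive_iff] at hM ⊢
  obtain ⟨hbij, hExt, hExt'⟩ := hM
  have hfs : Function.Surjective (f.lcomp R R) := surjective_lcomp hf hfg hg (hExt 0)
  have hgi : Function.Injective (g.lcomp R R) := injective_lcomp hg
  have hex : Function.Exact (g.lcomp R R) (f.lcomp R R) := exact_lcomp hfg hg
  refine ⟨⟨?_, fun ψ => ?_⟩, fun i => ?_, fun i => ?_⟩
  · rw [injective_iff_map_eq_zero]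
    intro n hn
    apply hf
    apply (Module.bijective_dual_eval R F).injective
    ext φ
    simpa using LinearMap.congr_fun hn (f.lcomp R R φ)
  · obtain ⟨v, hv⟩ := (Module.bijective_dual_eval R F).surjective (ψ ∘ₗ f.lcomp R R)
    have hv' (φ : Module.Dual R F) : φ v = ψ (f.lcomp R R φ) := LinearMap.congr_fun hv φ
    have hgv : g v = 0 := by
      apply hbij.injective
      ext μ
      have h := hv' (g.lcomp R R μ)
      rw [hex.apply_apply_eq_zero, map_zero] at h
      simpa using h
    obtain ⟨n, rfl⟩ := (hfg v).1 hgv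
    refine ⟨n, ?_⟩
    ext φ
    obtain ⟨φ, rfl⟩ := hfs φ
    exact hv' φ
  · exact ExtVanishes.left_sub hf hfg hg (extVanishes_of_projective _ _) (hExt _)
  · rcases i with _ | i
    · refine ExtVanishes.left_quot_one hgi hex hfs (fun ψ => ?_) (extVanishes_of_projective _ _)
      obtain ⟨m, rfl⟩ := hbij.surjective ψ
      obtain ⟨v, rfl⟩ := hg m
      exact ⟨Module.Dual.eval R F v, rfl⟩
    · exact ExtVanishes.left_quot hgi hex hfs (hExt' i) (extVanishes_of_projective _ _)

/-- A finite module over a noetherian ring is a quotient of a finite free module by a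
finite module. -/
lemma exists_finite_free_presentation [IsNoetherianRing R] (M : Type u) [AddCommGroup M]
    [Module R M] [Module.Finite R M] :
    ∃ (n : ℕ) (N : Submodule R (Fin n → R)) (g : (Fin n → R) →ₗ[R] M),
      Function.Surjective g ∧ Function.Exact N.subtype g := by
  obtain ⟨n, g, hg⟩ := Module.Finite.exists_fin' R M
  exact ⟨n, LinearMap.ker g, g, hg, g.exact_subtype_ker_map⟩

lemma IsTotallyReflexive.extVanishes_of_hasFiniteInjectiveDimension [IsNoetherianRing R]
    {Q : Type u} [AddCommGroup Q] [Module R Q] (hQ : HasFiniteInjectiveDimension R Q)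
    (hM : IsTotallyReflexive R M) [Module.Finite R M] (i : ℕ) : ExtVanishes R M Q (i + 1) := by
  obtain ⟨n, hn⟩ := hQ
  simp only [subsingleton_extModule_iff] at hn
  suffices H : ∀ (j : ℕ) (M : Type u) [AddCommGroup M] [Module R M] [Module.Finite R M],
      IsTotallyReflexive R M → ∀ i, n ≤ i + j → ExtVanishes R M Q (i + 1) from
    H n M hM i (Nat.le_add_left _ _)
  intro j
  induction j with
  | zero => exact fun M _ _ _ _ i hi => hn M _ (by lia)
  | succ j ih =>
    intro M _ _ _ hM i hi
    obtain ⟨n, N, g, hg, hex⟩ := exists_finite_free_presentation (R := R) (Module.Dual R M)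
    have hN : IsTotallyReflexive R N := hM.dual.syzygy N.injective_subtype hex hg
    have hExt := ((isTotallyReflexive_iff _).1 hM.dual).2.1 0
    have : Module.IsReflexive R M := ⟨hM.1⟩
    refine ExtVanishes.congr_left (Module.evalEquiv R M).symm ?_
    exact ExtVanishes.left_sub (injective_lcomp hg) (exact_lcomp hex hg)
      (surjective_lcomp N.injective_subtype hex hg hExt) (extVanishes_of_projective _ _)
      (ih _ hN.dual (i + 1) (by lia))

end TotallyReflexive

section TensorEvaluation

open TensorProduct

variable {R : Type u} [CommRing R]

/-- The natural map `X ⊗ Q → Hom(X*, Q)` sending `x ⊗ q` to `φ ↦ φ x • q`. -/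
noncomputable def tensorEvaluation (X Q : Type u) [AddCommGroup X] [Module R X]
    [AddCommGroup Q] [Module R Q] : X ⊗[R] Q →ₗ[R] (Module.Dual R X →ₗ[R] Q) :=
  dualTensorHom R (Module.Dual R X) Q ∘ₗ (Module.Dual.eval R X).rTensor Q

@[simp]
lemma tensorEvaluation_tmul {X Q : Type u} [AddCommGroup X] [Module R X]
    [AddCommGroup Q] [Module R Q] (x : X) (q : Q) (φ : Module.Dual R X) :
    tensorEvaluation X Q (x ⊗ₜ[R] q) φ = φ x • q := by
  simp [tensorEvaluation]

lemma tensorEvaluation_bijective_of_projective (X Q : Type u) [AddCommGroup X] [Module R X]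
    [AddCommGroup Q] [Module R Q] [Module.Finite R X] [Module.Projective R X] :
    Function.Bijective (tensorEvaluation (R := R) X Q) :=
  (dualTensorHom_bijective (R := R) (M := Module.Dual R X) (N := Q)).comp
    ((Module.evalEquiv R X).rTensor Q).bijective

variable {N F M Q : Type u} [AddCommGroup N] [Module R N] [AddCommGroup F] [Module R F]
  [AddCommGroup M] [Module R M] [AddCommGroup Q] [Module R Q]
  {f : N →ₗ[R] F} {g : F →ₗ[R] M}

lemma tensorEvaluation_rTensor (g : F →ₗ[R] M) (z : F ⊗[R] Q) :
    tensorEvaluation M Q (g.rTensor Q z) = (g.lcomp R R).lcomp R Q (tensorEvaluation F Q z) := by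
  refine LinearMap.congr_fun (f := tensorEvaluation M Q ∘ₗ g.rTensor Q)
    (g := (g.lcomp R R).lcomp R Q ∘ₗ tensorEvaluation F Q) ?_ z
  ext
  simp

variable [IsNoetherianRing R]

lemma IsTotallyReflexive.tensorEvaluation_surjective (hQ : HasFiniteInjectiveDimension R Q)
    (hM : IsTotallyReflexive R M) [Module.Finite R M] :
    Function.Surjective (tensorEvaluation (R := R) M Q) := by
  obtain ⟨n, N, g, hg, hex⟩ := exists_finite_free_presentation (R := R) M
  have hN : IsTotallyReflexive R N := hM.syzygy N.injective_subtype hex hg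
  have hsurj : Function.Surjective ((g.lcomp R R).lcomp R Q) :=
    surjective_lcomp (injective_lcomp hg) (exact_lcomp hex hg)
      (surjective_lcomp N.injective_subtype hex hg (((isTotallyReflexive_iff _).1 hM).2.1 0))
      (hN.dual.extVanishes_of_hasFiniteInjectiveDimension hQ 0)
  intro ψ
  obtain ⟨χ, rfl⟩ := hsurj ψ
  obtain ⟨z, rfl⟩ := (tensorEvaluation_bijective_of_projective (Fin n → R) Q).surjective χ
  exact ⟨_, tensorEvaluation_rTensor g z⟩

lemma IsTotallyReflexive.tensorEvaluation_bijective (hQ : HasFiniteInjectiveDimension R Q)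
    (hM : IsTotallyReflexive R M) [Module.Finite R M] :
    Function.Bijective (tensorEvaluation (R := R) M Q) := by
  refine ⟨?_, hM.tensorEvaluation_surjective hQ⟩
  obtain ⟨n, N, g, hg, hex⟩ := exists_finite_free_presentation (R := R) M
  have hN : IsTotallyReflexive R N := hM.syzygy N.injective_subtype hex hg
  have hdual : Function.Surjective (N.subtype.lcomp R R) :=
    surjective_lcomp N.injective_subtype hex hg (((isTotallyReflexive_iff _).1 hM).2.1 0)
  rw [injective_iff_map_eq_zero]
  intro x hx
  obtain ⟨y, rfl⟩ := LinearMap.rTensor_surjective Q hg x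
  rw [tensorEvaluation_rTensor] at hx
  obtain ⟨ψ, hψ⟩ := (exact_lcomp (exact_lcomp hex hg) hdual _).1 hx
  obtain ⟨z, rfl⟩ := hN.tensorEvaluation_surjective hQ ψ
  rw [← tensorEvaluation_rTensor] at hψ
  obtain rfl := (tensorEvaluation_bijective_of_projective (Fin n → R) Q).injective hψ
  exact (rTensor_exact Q hex hg).apply_apply_eq_zero z

lemma IsTotallyReflexive.rTensor_injective (hQ : HasFiniteInjectiveDimension R Q)
    (hM : IsTotallyReflexive R M) [Module.Finite R F] [Module.Projective R F]
    (hf : Function.Injective f) (hfg : Function.Exact f g) (hg : Function.Surjective g) :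
    Function.Injective (f.rTensor Q) := by
  have : Module.Finite R N := Module.Finite.of_injective f hf
  have hN : IsTotallyReflexive R N := hM.syzygy hf hfg hg
  have hdual : Function.Surjective (f.lcomp R R) :=
    surjective_lcomp hf hfg hg (((isTotallyReflexive_iff _).1 hM).2.1 0)
  rw [injective_iff_map_eq_zero]
  intro x hx
  apply (hN.tensorEvaluation_bijective hQ).injective
  apply injective_lcomp (Y := Q) hdual
  rw [← tensorEvaluation_rTensor, hx, map_zero, map_zero, map_zero]

end TensorEvaluation

section TorVanishing

open TensorProduct

variable {R : Type u} [CommRing R]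

/-- Tensoring with `Q` preserves the injectivity of syzygies of finite totally reflexive modules
in finite projective modules; equivalently, `Tor_1(M, Q) = 0` for all finite totally reflexive
`M`. -/
def PreservesReflexiveSyzygies (R : Type u) [CommRing R] (Q : Type u) [AddCommGroup Q]
    [Module R Q] : Prop :=
  ∀ (N F M : Type u) [AddCommGroup N] [Module R N] [AddCommGroup F] [Module R F]
    [AddCommGroup M] [Module R M] [Module.Finite R F] [Module.Projective R F]
    (f : N →ₗ[R] F) (g : F →ₗ[R] M), IsTotallyReflexive R M → Function.Injective f →
      Function.Exact f g → Function.Surjective g → Function.Injective (f.rTensor Q)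

variable [IsNoetherianRing R] {K P Q : Type u} [AddCommGroup K] [Module R K]
  [AddCommGroup P] [Module R P] [AddCommGroup Q] [Module R Q]
  {k : K →ₗ[R] P} {p : P →ₗ[R] Q}

lemma PreservesReflexiveSyzygies.lTensor_injective (hQ : PreservesReflexiveSyzygies R Q)
    {M : Type u} [AddCommGroup M] [Module R M] [Module.Finite R M] (hM : IsTotallyReflexive R M)
    [Module.Flat R P] (hk : Function.Injective k) (hkp : Function.Exact k p)
    (hp : Function.Surjective p) : Function.Injective (k.lTensor M) := by
  obtain ⟨n, N, g, hg, hex⟩ := exists_finite_free_presentation (R := R) M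
  rw [injective_iff_map_eq_zero]
  intro x hx
  obtain ⟨y, rfl⟩ := LinearMap.rTensor_surjective K hg x
  have comm (A B : Type u) [AddCommGroup A] [Module R A] [AddCommGroup B] [Module R B]
      {C D : Type u} [AddCommGroup C] [Module R C] [AddCommGroup D] [Module R D]
      (a : A →ₗ[R] B) (c : C →ₗ[R] D) (z : A ⊗[R] C) :
      c.lTensor B (a.rTensor C z) = a.rTensor D (c.lTensor A z) := by
    rw [← LinearMap.comp_apply, ← LinearMap.comp_apply, LinearMap.lTensor_comp_rTensor,
      LinearMap.rTensor_comp_lTensor]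
  rw [comm] at hx
  obtain ⟨z, hz⟩ := (rTensor_exact P hex hg _).1 hx
  have hz₀ : p.lTensor N z = 0 := by
    apply hQ N _ M N.subtype g hM N.injective_subtype hex hg
    rw [← comm, hz, (lTensor_exact _ hkp hp).apply_apply_eq_zero, map_zero]
  obtain ⟨w, rfl⟩ := (lTensor_exact N hkp hp _).1 hz₀
  rw [← comm] at hz
  obtain rfl := Module.Flat.lTensor_preserves_injective_linearMap k hk hz
  exact (rTensor_exact K hex hg).apply_apply_eq_zero w

lemma PreservesReflexiveSyzygies.syzygy (hQ : PreservesReflexiveSyzygies R Q)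
    [Module.Flat R P] (hk : Function.Injective k) (hkp : Function.Exact k p)
    (hp : Function.Surjective p) : PreservesReflexiveSyzygies R K := by
  intro N F M _ _ _ _ _ _ _ _ f g hM hf hfg hg
  have : Module.Finite R N := Module.Finite.of_injective f hf
  have hN : IsTotallyReflexive R N := hM.syzygy hf hfg hg
  have h : Function.Injective (f.rTensor P ∘ₗ k.lTensor N) :=
    (Module.Flat.rTensor_preserves_injective_linearMap f hf).comp
      (hQ.lTensor_injective hN hk hkp hp)
  rw [LinearMap.rTensor_comp_lTensor, ← LinearMap.lTensor_comp_rTensor, LinearMap.coe_comp] at h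
  exact h.of_comp

lemma PreservesReflexiveSyzygies.subsingleton_torModule (hQ : PreservesReflexiveSyzygies R Q)
    {M : Type u} [AddCommGroup M] [Module R M] [Module.Finite R M] (hM : IsTotallyReflexive R M)
    (i : ℕ) : Subsingleton (torModule R M Q (i + 1)) := by
  let P := ProjectiveResolution.of (ModuleCat.of R Q)
  have hflat (n : ℕ) : Module.Flat R (P.complex.X n) := by
    have : Module.Projective R (P.complex.X n) :=
      (IsProjective.iff_projective _).2 (P.projective n)
    infer_instance
  let d (n : ℕ) : P.complex.X (n + 1) →ₗ[R] P.complex.X n := (P.complex.d (n + 1) n).hom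
  let π : P.complex.X 0 →ₗ[R] Q := (show P.complex.X 0 ⟶ ModuleCat.of R Q from P.π.f 0).hom
  have hπ : Function.Surjective π :=
    (ModuleCat.epi_iff_surjective _).1 (inferInstance : Epi (P.π.f 0))
  have hexπ : Function.Exact (d 0) π :=
    (ShortComplex.ShortExact.moduleCat_exact_iff_function_exact _).1 P.exact₀
  have hexd (n : ℕ) : Function.Exact (d (n + 1)) (d n) :=
    (ShortComplex.ShortExact.moduleCat_exact_iff_function_exact _).1 (P.exact_succ n)
  have key (n : ℕ) : PreservesReflexiveSyzygies R (d n).range ∧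
      Function.Injective ((d n).range.subtype.lTensor M) := by
    induction n with
    | zero =>
      have hex : Function.Exact (d 0).range.subtype π := by
        intro x
        rw [hexπ x]
        simp
      exact ⟨hQ.syzygy (Submodule.injective_subtype _) hex hπ,
        hQ.lTensor_injective hM (Submodule.injective_subtype _) hex hπ⟩
    | succ n ih =>
      exact ⟨ih.1.syzygy (Submodule.injective_subtype _) (hexd n).linearMap_rangeRestrict
          (LinearMap.surjective_rangeRestrict _),
        ih.1.lTensor_injective hM (Submodule.injective_subtype _) (hexd n).linearMap_rangeRestrict
          (LinearMap.surjective_rangeRestrict _)⟩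
  have hexact : Function.Exact ((d (i + 1)).lTensor M) ((d i).lTensor M) := by
    have h : (d i).range.subtype ∘ₗ (d i).rangeRestrict = d i := rfl
    rw [← h, LinearMap.lTensor_comp, (key i).2.comp_exact_iff_exact]
    refine lTensor_exact M (Function.Injective.comp_exact_iff_exact
      (i := (d i).range.subtype) (Submodule.injective_subtype _) |>.1 (hexd i))
      (LinearMap.surjective_rangeRestrict _)
  unfold torModule
  rw [← ModuleCat.isZero_iff_subsingleton]
  refine Limits.IsZero.of_iso ?_ (P.isoLeftDerivedObj _ (i + 1))
  rw [HomologicalComplex.homologyFunctor_obj, ← HomologicalComplex.exactAt_iff_isZero_homology,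
    HomologicalComplex.exactAt_iff' _ (i + 2) (i + 1) i (by simp) (by simp),
    ShortComplex.ShortExact.moduleCat_exact_iff_function_exact]
  exact hexact

end TorVanishing

section Depth

variable {R : Type u} [CommRing R] {K X Y : Type u} [AddCommGroup K] [Module R K]
  [AddCommGroup X] [Module R X] [AddCommGroup Y] [Module R Y]

lemma ExtVanishes.hom_free {m : ℕ} (n : ℕ) (h : ExtVanishes R K Y m) :
    ExtVanishes R K ((Fin n → R) →ₗ[R] Y) m := by
  refine subsingleton_of_forall_eq 0 fun x => ?_
  have hid : 𝟙 (ModuleCat.of R ((Fin n → R) →ₗ[R] Y)) = ∑ j : Fin n,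
      ModuleCat.ofHom (LinearMap.applyₗ (R := R) (M₂ := Y) (Pi.single j (1 : R) : Fin n → R)) ≫
        ModuleCat.ofHom (LinearMap.smulRightₗ (LinearMap.proj (R := R) (φ := fun _ => R) j)) := by
    ext φ
    simp [ModuleCat.hom_sum]
  rw [← Abelian.Ext.comp_mk₀_id x, hid, Abelian.Ext.mk₀_sum, Abelian.Ext.comp_sum]
  refine Finset.sum_eq_zero fun j _ => ?_
  rw [← Abelian.Ext.mk₀_comp_mk₀, ← Abelian.Ext.comp_assoc_of_second_deg_zero]
  rw [show x.comp (Abelian.Ext.mk₀ (ModuleCat.ofHom (LinearMap.applyₗ _))) (add_zero m) = 0 from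
    h.elim _ _, Abelian.Ext.zero_comp]

lemma ext_comp_smulRight_eq_zero {n m : ℕ}
    (e : Abelian.Ext (ModuleCat.of R K) (ModuleCat.of R Y) n) (c : (Fin m → R) →ₗ[R] R)
    (he : ∀ v, c v • e = 0) :
    e.comp (Abelian.Ext.mk₀ (ModuleCat.ofHom (LinearMap.smulRightₗ c))) (add_zero n) = 0 := by
  have hc : ModuleCat.ofHom (LinearMap.smulRightₗ (M := Y) c) = ∑ j : Fin m, c (Pi.single j 1) •
      ModuleCat.ofHom (LinearMap.smulRightₗ (LinearMap.proj (R := R) (φ := fun _ => R) j)) := by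
    ext y j
    simp [ModuleCat.hom_sum, Pi.single_apply]
  rw [hc, Abelian.Ext.mk₀_sum, Abelian.Ext.comp_sum]
  refine Finset.sum_eq_zero fun j _ => ?_
  rw [Abelian.Ext.mk₀_smul, Abelian.Ext.comp_smul, ← Abelian.Ext.smul_comp, he,
    Abelian.Ext.zero_comp]

lemma smul_ext_eq_zero_of_annihilates {n : ℕ} {a : R} (ha : ∀ x : K, a • x = 0)
    (e : Abelian.Ext (ModuleCat.of R K) (ModuleCat.of R Y) n) : a • e = 0 := by
  have h : a • 𝟙 (ModuleCat.of R K) = 0 := by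
    ext x
    exact ha x
  rw [← Abelian.Ext.mk₀_id_comp e, ← Abelian.Ext.smul_comp, ← Abelian.Ext.mk₀_smul, h,
    Abelian.Ext.mk₀_zero, Abelian.Ext.zero_comp]

lemma IsTotallyReflexive.nontrivial_dual [Nontrivial X] (hX : IsTotallyReflexive R X) :
    Nontrivial (Module.Dual R X) := by
  by_contra! h
  exact not_subsingleton X hX.1.injective.subsingleton

lemma ExtVanishes.hom [IsNoetherianRing R] [Module.Finite R X]
    (hXY : ∀ i, ExtVanishes R X Y (i + 1)) {d : ℕ} (hY : ∀ i < d, ExtVanishes R K Y i) : ∀ i < d, ExtVanishes R K (X →ₗ[R] Y) i := by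
  intro i
  induction i using Nat.strong_induction_on generalizing X with
  | _ i ih =>
    intro hi
    obtain ⟨n, N, g, hg, hex⟩ := exists_finite_free_presentation (R := R) X
    have hN (j : ℕ) : ExtVanishes R N Y (j + 1) :=
      ExtVanishes.left_sub N.injective_subtype hex hg (extVanishes_of_projective _ _) (hXY _)
    exact ExtVanishes.right_sub (injective_lcomp hg) (exact_lcomp hex hg)
      (surjective_lcomp N.injective_subtype hex hg (hXY 0))
      (fun j hj => ih j hj hN (hj.trans hi)) ((hY i hi).hom_free n)

variable [IsLocalRing R]

lemma le_moduleDepth_iff {Y : Type u} [AddCommGroup Y] [Module R Y] (d : ℕ) :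
    (d : ℕ∞) ≤ moduleDepth R Y ↔ ∀ i < d, ExtVanishes R (IsLocalRing.ResidueField R) Y i := by
  simp only [moduleDepth, le_sInf_iff, Set.mem_ofPred_eq, forall_exists_index, and_imp,
    ← not_subsingleton_iff_nontrivial, subsingleton_extModule_iff]
  rw [forall_comm]
  refine forall_congr' fun i => ?_
  rw [forall_eq, Nat.cast_le, ← not_lt, not_imp_not]

lemma moduleDepth_eq_of_le_iff {Y Z : Type u} [AddCommGroup Y] [Module R Y]
    [AddCommGroup Z] [Module R Z]
    (h : ∀ d : ℕ, (∀ i < d, ExtVanishes R (IsLocalRing.ResidueField R) Y i) ↔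
      ∀ i < d, ExtVanishes R (IsLocalRing.ResidueField R) Z i) :
    moduleDepth R Y = moduleDepth R Z :=
  ENat.eq_of_forall_natCast_le_iff fun d => by rw [le_moduleDepth_iff, le_moduleDepth_iff, h]

lemma moduleDepth_congr {Y Z : Type u} [AddCommGroup Y] [Module R Y]
    [AddCommGroup Z] [Module R Z] (e : Y ≃ₗ[R] Z) : moduleDepth R Y = moduleDepth R Z :=
  moduleDepth_eq_of_le_iff fun _ => forall₂_congr fun _ _ =>
    ⟨fun h => h.congr_right e, fun h => h.congr_right e.symm⟩

lemma moduleDepth_eq_top (Y : Type u) [AddCommGroup Y] [Module R Y] [Subsingleton Y] :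
    moduleDepth R Y = ⊤ := by
  refine ENat.eq_top_iff_forall_ge.2 fun d => (le_moduleDepth_iff d).2 fun i _ => ?_
  refine subsingleton_of_forall_eq 0 fun x => ?_
  rw [← Abelian.Ext.comp_mk₀_id x, (ModuleCat.isZero_of_subsingleton (ModuleCat.of R Y)).eq_of_src
    (𝟙 _) 0, Abelian.Ext.mk₀_zero, Abelian.Ext.comp_zero]

lemma exists_surjective_residueField (X : Type u) [AddCommGroup X] [Module R X]
    [Module.Finite R X] [Nontrivial X] :
    ∃ π : X →ₗ[R] IsLocalRing.ResidueField R, Function.Surjective π := by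
  obtain ⟨S, hS, -⟩ := (eq_top_or_exists_le_coatom (⊥ : Submodule R X)).resolve_left bot_ne_top
  have : IsSimpleModule R (X ⧸ S) := isSimpleModule_iff_isCoatom.2 hS
  obtain ⟨I, hI, ⟨e⟩⟩ := isSimpleModule_iff_quot_maximal.1 this
  obtain rfl := IsLocalRing.eq_maximalIdeal hI
  exact ⟨e.toLinearMap ∘ₗ S.mkQ, e.surjective.comp S.mkQ_surjective⟩

variable [IsNoetherianRing R]

lemma not_extVanishes_hom [Module.Finite R X] [Nontrivial X]
    (hXY : ∀ i, ExtVanishes R X Y (i + 1)) {d : ℕ}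
    (hd : ∀ i < d, ExtVanishes R (IsLocalRing.ResidueField R) Y i)
    (hY : ¬ ExtVanishes R (IsLocalRing.ResidueField R) Y d) :
    ¬ ExtVanishes R (IsLocalRing.ResidueField R) (X →ₗ[R] Y) d := by
  intro hvan
  refine hY (subsingleton_of_forall_eq 0 fun e => ?_)
  obtain ⟨n, N, g, hg, hex⟩ := exists_finite_free_presentation (R := R) X
  obtain ⟨m, N', g', hg', hex'⟩ := exists_finite_free_presentation (R := R) N
  have hN (j : ℕ) : ExtVanishes R N Y (j + 1) :=
    ExtVanishes.left_sub N.injective_subtype hex hg (extVanishes_of_projective _ _) (hXY _)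
  have hN' (j : ℕ) : ExtVanishes R N' Y (j + 1) :=
    ExtVanishes.left_sub N'.injective_subtype hex' hg' (extVanishes_of_projective _ _) (hN _)
  obtain ⟨π, hπ⟩ := exists_surjective_residueField (R := R) X
  obtain ⟨c, hc⟩ := Module.projective_lifting_property
    (Algebra.linearMap R (IsLocalRing.ResidueField R)) (π ∘ₗ g) IsLocalRing.residue_surjective
  have hc' (v : Fin n → R) : IsLocalRing.residue R (c v) = π (g v) := LinearMap.congr_fun hc v
  obtain ⟨v, hv⟩ := (hπ.comp hg) 1
  have hunit : IsUnit (c v) := by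
    rw [← IsLocalRing.residue_ne_zero_iff_isUnit, hc']
    simp_all
  obtain ⟨b, hb⟩ := hunit.exists_left_inv
  have hS := shortExact_exactShortComplex (injective_lcomp hg) (exact_lcomp hex hg)
      (surjective_lcomp N.injective_subtype hex hg (hXY 0))
  let θ : ModuleCat.of R Y ⟶ ModuleCat.of R ((Fin n → R) →ₗ[R] Y) :=
    ModuleCat.ofHom (LinearMap.smulRightₗ c)
  have hθ : θ ≫ ModuleCat.ofHom (LinearMap.applyₗ (b • v)) = 𝟙 _ := by
    ext y
    simp [θ, smul_smul, hb]
  have hzero : (e.comp (Abelian.Ext.mk₀ θ) (add_zero d)).comp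
      (Abelian.Ext.mk₀ (ModuleCat.ofHom (N.subtype.lcomp R Y))) (add_zero d) = 0 := by
    apply injective_ext_comp (injective_lcomp hg') (exact_lcomp hex' hg')
      (surjective_lcomp N'.injective_subtype hex' hg' (hN 0)) (ExtVanishes.hom hN' hd)
    rw [Abelian.Ext.comp_assoc_of_second_deg_zero, Abelian.Ext.comp_assoc_of_second_deg_zero,
      Abelian.Ext.mk₀_comp_mk₀, Abelian.Ext.mk₀_comp_mk₀]
    refine ext_comp_smulRight_eq_zero e (c ∘ₗ N.subtype ∘ₗ g') fun w =>
      smul_ext_eq_zero_of_annihilates (fun x => ?_) e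
    have : IsLocalRing.residue R (c (g' w)) = 0 := by
      rw [hc', show g (g' w) = 0 from hex.apply_apply_eq_zero _, map_zero]
    rw [← algebraMap_smul (IsLocalRing.ResidueField R)]
    exact (congrArg (· • x) this).trans (zero_smul _ x)
  obtain ⟨y, hy⟩ := Abelian.Ext.covariant_sequence_exact₂ _ hS _ hzero
  rw [show y = 0 from hvan.elim _ _, Abelian.Ext.zero_comp] at hy
  rw [← Abelian.Ext.comp_mk₀_id e, ← hθ, ← Abelian.Ext.mk₀_comp_mk₀,
    ← Abelian.Ext.comp_assoc_of_second_deg_zero, ← hy, Abelian.Ext.zero_comp]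

/-- If `Ext^i(X, Y) = 0` for all `i > 0`, then `Hom(X, Y)` has the same depth as `Y`. -/
lemma moduleDepth_hom [Module.Finite R X] [Nontrivial X]
    (hXY : ∀ i, ExtVanishes R X Y (i + 1)) : moduleDepth R (X →ₗ[R] Y) = moduleDepth R Y := by
  refine moduleDepth_eq_of_le_iff fun d => ⟨fun h i => ?_, ExtVanishes.hom hXY⟩
  induction i using Nat.strong_induction_on with
  | _ i ih =>
    intro hi
    by_contra hY
    exact not_extVanishes_hom hXY (fun j hj => ih j hj (hj.trans hi)) hY (h i hi)

lemma IsTotallyReflexive.moduleDepth_eq {M : Type u} [AddCommGroup M] [Module R M]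
    [Module.Finite R M] [Nontrivial M] (hM : IsTotallyReflexive R M) :
    moduleDepth R M = moduleDepth R R := by
  have : Module.IsReflexive R M := ⟨hM.1⟩
  have : Nontrivial (Module.Dual R M) := hM.nontrivial_dual
  rw [moduleDepth_congr (Module.evalEquiv R M)]
  exact moduleDepth_hom ((isTotallyReflexive_iff _).1 hM).2.2

lemma IsTotallyReflexive.moduleDepth_tensorProduct {M Q : Type u} [AddCommGroup M] [Module R M]
    [AddCommGroup Q] [Module R Q] [Module.Finite R M] [Nontrivial M]
    (hM : IsTotallyReflexive R M) (hQ : HasFiniteInjectiveDimension R Q) :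
    moduleDepth R (TensorProduct R M Q) = moduleDepth R Q := by
  have := hM.nontrivial_dual
  rw [moduleDepth_congr (LinearEquiv.ofBijective _ (hM.tensorEvaluation_bijective hQ))]
  exact moduleDepth_hom (hM.dual.extVanishes_of_hasFiniteInjectiveDimension hQ)

end Depth

/-- Let `R` be a noetherian local ring, `M` a totally reflexive `R`-module and `Q` a finitely
generated `R`-module of finite injective dimension.  Then `Tor_i(M, Q) = 0` for all `i > 0`
and `depth(M ⊗ Q) + depth R = depth M + depth Q`. -/
theorem tor_vanishing_and_depth_formula_of_finite_injdim
    (R : Type u) [CommRing R] [IsNoetherianRing R] [IsLocalRing R]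
    (M Q : Type u) [AddCommGroup M] [Module R M] [Module.Finite R M]
    [AddCommGroup Q] [Module R Q] [Module.Finite R Q]
    (hM : IsTotallyReflexive R M) (hQ : HasFiniteInjectiveDimension R Q) :
    (∀ i : ℕ, 0 < i → Subsingleton (torModule R M Q i)) ∧
      moduleDepth R (TensorProduct R M Q) + moduleDepth R R =
        moduleDepth R M + moduleDepth R Q := by
  have hsyz : PreservesReflexiveSyzygies R Q :=
    fun _ _ _ _ _ _ _ _ _ _ _ _ _ hM hf hfg hg => hM.rTensor_injective hQ hf hfg hg
  refine ⟨fun i hi => ?_, ?_⟩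
  · obtain ⟨i, rfl⟩ := Nat.exists_eq_add_one.2 hi
    exact hsyz.subsingleton_torModule hM i
  · rcases subsingleton_or_nontrivial M with _ | _
    · rw [moduleDepth_eq_top M, moduleDepth_eq_top (TensorProduct R M Q), top_add, top_add]
    · rw [hM.moduleDepth_tensorProduct hQ, hM.moduleDepth_eq, add_comm]
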